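/- Define f = (f^1, f^2, f^3) : ℝ^4 ∖ {0} → ℝ^3 (the Lawson–Osserman cone) by f(x) = (√5 / (2|x|)) · (x_1² + x_2² − x_3² − x_4², 2(x_1x_3 + x_2x_4), 2(x_2x_3 − x_1x_4)), where |x| = (x_1²+x_2²+x_3²+x_4²)^{1/2}. Let g(x) be the 4×4 matrix with entries g_{ij}(x) = δ_{ij} + Σ_{α=1}^3 ∂f^α/∂x^i (x) ∂f^α/∂x^j (x). Then det g(x) = 81 for every x ≠ 0; equivalently, the slope function Δ_f(x) = (det g(x))^{1/2} is identically equal to 9. -/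

import Mathlib

noncomputable section

open scoped BigOperators

/-- Partial derivative of a scalar function on `ℝ^n` in the `i`-th coordinate direction. -/
def pderiv' {n : ℕ} (i : Fin n) (φ : (Fin n → ℝ) → ℝ) (x : Fin n → ℝ) : ℝ :=
  fderiv ℝ φ x (Pi.single i 1)

/-- The induced metric `g_{ij} = δ_{ij} + Σ_α ∂f^α/∂x^i ∂f^α/∂x^j` of the graph of `f`. -/
def graphMetric {n m : ℕ} (f : (Fin n → ℝ) → (Fin m → ℝ)) (x : Fin n → ℝ) :
    Matrix (Fin n) (Fin n) ℝ :=
  Matrix.of fun i j => (if i = j then (1 : ℝ) else 0) +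
    ∑ α : Fin m, pderiv' i (fun y => f y α) x * pderiv' j (fun y => f y α) x

/-- The Euclidean norm `|x| = (x₁² + x₂² + x₃² + x₄²)^{1/2}` on `ℝ⁴`. -/
def euclNorm4 (x : Fin 4 → ℝ) : ℝ :=
  Real.sqrt (x 0 ^ 2 + x 1 ^ 2 + x 2 ^ 2 + x 3 ^ 2)

/-- The Hopf map `ε : ℝ⁴ → ℝ³`. -/
def hopfMap (x : Fin 4 → ℝ) : Fin 3 → ℝ :=
  ![x 0 ^ 2 + x 1 ^ 2 - x 2 ^ 2 - x 3 ^ 2,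
    2 * (x 0 * x 2 + x 1 * x 3),
    2 * (x 1 * x 2 - x 0 * x 3)]

/-- The Lawson–Osserman cone map `f(x) = (√5 / (2|x|)) · ε(x)`. -/
def LOmap (x : Fin 4 → ℝ) : Fin 3 → ℝ :=
  fun α => Real.sqrt 5 / (2 * euclNorm4 x) * hopfMap x α

/-- The Jacobian matrix of the Hopf map. -/
def hopfJacobian (x : Fin 4 → ℝ) : Matrix (Fin 3) (Fin 4) ℝ :=
  !![2 * x 0, 2 * x 1, -2 * x 2, -2 * x 3;
    2 * x 2, 2 * x 3, 2 * x 0, 2 * x 1;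
    -2 * x 3, 2 * x 2, 2 * x 1, -2 * x 0]

/-- The direction of the Hopf fibre through `x`. -/
def hopfFibre (x : Fin 4 → ℝ) : Fin 4 → ℝ :=
  ![-x 1, x 0, -x 3, x 2]

theorem sum_sq_pos_of_ne_zero {x : Fin 4 → ℝ} (hx : x ≠ 0) :
    0 < x 0 ^ 2 + x 1 ^ 2 + x 2 ^ 2 + x 3 ^ 2 := by
  obtain ⟨i, hi⟩ := Function.ne_iff.mp hx
  have hpos : 0 < x i ^ 2 := sq_pos_of_ne_zero hi
  fin_cases i <;> simp at hpos <;> positivity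

theorem euclNorm4_pos {x : Fin 4 → ℝ} (hx : x ≠ 0) : 0 < euclNorm4 x :=
  Real.sqrt_pos.mpr (sum_sq_pos_of_ne_zero hx)

theorem euclNorm4_sq (x : Fin 4 → ℝ) :
    euclNorm4 x ^ 2 = x 0 ^ 2 + x 1 ^ 2 + x 2 ^ 2 + x 3 ^ 2 :=
  Real.sq_sqrt (by positivity)

theorem hasFDerivAt_hopfMap (x : Fin 4 → ℝ) (α : Fin 3) :
    HasFDerivAt (fun y => hopfMap y α)
      (∑ i, hopfJacobian x α i • ContinuousLinearMap.proj (R := ℝ) (φ := fun _ => ℝ) i) x := by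
  have h (i : Fin 4) : HasFDerivAt (fun y : Fin 4 → ℝ => y i)
      (ContinuousLinearMap.proj (R := ℝ) (φ := fun _ => ℝ) i) x := hasFDerivAt_apply i x
  fin_cases α
  · refine (((((h 0).pow 2).add ((h 1).pow 2)).sub ((h 2).pow 2)).sub
      ((h 3).pow 2)).congr_fderiv ?_
    ext v
    simp [hopfJacobian, Fin.sum_univ_four]
    ring
  · refine ((((h 0).mul (h 2)).add ((h 1).mul (h 3))).const_mul 2).congr_fderiv ?_
    ext v
    simp [hopfJacobian, Fin.sum_univ_four]
    ring
  · refine ((((h 1).mul (h 2)).sub ((h 0).mul (h 3))).const_mul 2).congr_fderiv ?_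
    ext v
    simp [hopfJacobian, Fin.sum_univ_four]
    ring

theorem hasFDerivAt_euclNorm4 {x : Fin 4 → ℝ} (hx : x ≠ 0) :
    HasFDerivAt euclNorm4
      (∑ i, (x i / euclNorm4 x) • ContinuousLinearMap.proj (R := ℝ) (φ := fun _ => ℝ) i) x := by
  have h (i : Fin 4) : HasFDerivAt (fun y : Fin 4 → ℝ => y i)
      (ContinuousLinearMap.proj (R := ℝ) (φ := fun _ => ℝ) i) x := hasFDerivAt_apply i x
  have hr := (euclNorm4_pos hx).ne'
  refine (((((h 0).pow 2).add ((h 1).pow 2)).add ((h 2).pow 2)).add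
    ((h 3).pow 2)).sqrt (sum_sq_pos_of_ne_zero hx).ne' |>.congr_fderiv ?_
  change (1 / (2 * euclNorm4 x)) • _ = _
  ext v
  simp [Fin.sum_univ_four]
  field_simp

theorem pderiv'_LOmap {x : Fin 4 → ℝ} (hx : x ≠ 0) (i : Fin 4) (α : Fin 3) :
    pderiv' i (fun y => LOmap y α) x =
      Real.sqrt 5 / 2 * (hopfJacobian x α i / euclNorm4 x
        - hopfMap x α * x i / euclNorm4 x ^ 3) := by
  have hr := (euclNorm4_pos hx).ne'
  have hinv := (hasDerivAt_inv hr).comp_hasFDerivAt x (hasFDerivAt_euclNorm4 hx)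
  have hf := ((hinv.mul (hasFDerivAt_hopfMap x α)).const_mul (Real.sqrt 5 / 2))
  have heq : (fun y => LOmap y α) =
      fun y => Real.sqrt 5 / 2 * ((euclNorm4 y)⁻¹ * hopfMap y α) := by
    funext y
    simp only [LOmap, div_eq_mul_inv, mul_inv]
    ring
  rw [pderiv', heq]
  refine (congrArg (fun L => L (Pi.single i 1)) hf.fderiv).trans ?_
  simp [Pi.single_apply]
  field_simp
  ring

/-- The metric of the Lawson–Osserman cone is diagonal with respect to the radial direction,
the Hopf fibre direction and their orthogonal complement. -/
theorem graphMetric_LOmap {x : Fin 4 → ℝ} (hx : x ≠ 0) (i j : Fin 4) :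
    graphMetric LOmap x i j = 6 * (if i = j then 1 else 0)
      - 5 * (euclNorm4 x ^ 2)⁻¹ * (hopfFibre x i * hopfFibre x j)
      - 15 / 4 * (euclNorm4 x ^ 2)⁻¹ * (x i * x j) := by
  have hr := (euclNorm4_pos hx).ne'
  have h5 : Real.sqrt 5 ^ 2 = 5 := Real.sq_sqrt (by norm_num)
  have hJJ : ∑ α, hopfJacobian x α i * hopfJacobian x α j =
      4 * (euclNorm4 x ^ 2 * (if i = j then 1 else 0) - hopfFibre x i * hopfFibre x j) := by
    rw [euclNorm4_sq]
    fin_cases i <;> fin_cases j <;>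
      simp [Fin.sum_univ_three, hopfJacobian, hopfFibre] <;> ring
  have hJh (k : Fin 4) : ∑ α, hopfJacobian x α k * hopfMap x α = 2 * euclNorm4 x ^ 2 * x k := by
    rw [euclNorm4_sq]
    fin_cases k <;> simp [Fin.sum_univ_three, hopfJacobian, hopfMap] <;> ring
  have hhh : ∑ α, hopfMap x α * hopfMap x α = euclNorm4 x ^ 4 := by
    rw [show euclNorm4 x ^ 4 = (euclNorm4 x ^ 2) ^ 2 by ring, euclNorm4_sq]
    simp [Fin.sum_univ_three, hopfMap]
    ring
  have hsum : ∑ α, pderiv' i (fun y => LOmap y α) x * pderiv' j (fun y => LOmap y α) x =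
      Real.sqrt 5 ^ 2 / 4 * ((∑ α, hopfJacobian x α i * hopfJacobian x α j) / euclNorm4 x ^ 2
        - (∑ α, hopfJacobian x α i * hopfMap x α) * x j / euclNorm4 x ^ 4
        - (∑ α, hopfJacobian x α j * hopfMap x α) * x i / euclNorm4 x ^ 4
        + (∑ α, hopfMap x α * hopfMap x α) * (x i * x j) / euclNorm4 x ^ 6) := by
    simp only [pderiv'_LOmap hx, Fin.sum_univ_three]
    field_simp
    ring
  rw [graphMetric, Matrix.of_apply, hsum, hJJ, hJh, hJh, hhh, h5]
  field_simp
  ring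

theorem det_graphMetric_LOmap {x : Fin 4 → ℝ} (hx : x ≠ 0) :
    (graphMetric LOmap x).det = 81 := by
  have hdet : (graphMetric LOmap x).det =
      36 * (6 - 5 * ((euclNorm4 x ^ 2)⁻¹ * (x 0 ^ 2 + x 1 ^ 2 + x 2 ^ 2 + x 3 ^ 2)))
        * (6 - 15 / 4 * ((euclNorm4 x ^ 2)⁻¹ * (x 0 ^ 2 + x 1 ^ 2 + x 2 ^ 2 + x 3 ^ 2))) := by
    generalize ht : (euclNorm4 x ^ 2)⁻¹ = t
    simp [Matrix.det_succ_row_zero, Fin.sum_univ_succ, graphMetric_LOmap hx, ht, hopfFibre,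
      Fin.succAbove]
    ring
  rw [hdet, ← euclNorm4_sq, inv_mul_cancel₀ (pow_ne_zero 2 (euclNorm4_pos hx).ne')]
  norm_num

/-- **The slope of the Lawson–Osserman cone** (Appendix): the graph metric of the
Lawson–Osserman map satisfies `det g(x) = 81`, i.e. `Δ_f(x) = 9`, for every `x ≠ 0`. -/
theorem lawson_osserman_det_eq_81 (x : Fin 4 → ℝ) (hx : x ≠ 0) :
    (graphMetric LOmap x).det = 81 ∧ Real.sqrt (graphMetric LOmap x).det = 9 := by
  have h := det_graphMetric_LOmap hx
  refine ⟨h, ?_⟩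
  rw [h, show (81 : ℝ) = 9 ^ 2 by norm_num]
  exact Real.sqrt_sq (by norm_num)
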